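/- arXiv:1910.08946 — 2 statements merged into one kernel-verified Lean document; each statement's English description precedes it below -/
import Mathlib

section
/- Fix T > 0, x > 0 and L > 0. Let C : [0,T] × (0,∞) → ℝ satisfy: (i) for each y > 0 the map t ↦ C(t,y) is differentiable on [0,T] and the partial derivative ∂ₜC is jointly continuous on [0,T] × (0,∞); (ii) for each t ∈ [0,T] the map y ↦ C(t,y) is convex with one-sided derivatives bounded in absolute value by L; let C′₊(t,y) denote the right-hand derivative of y ↦ C(t,y). Let λ : [0,T] → ℝ be bounded and measurable and define g(t) := x · exp(∫₀ᵗ λ(u) du). Then the map t ↦ C(t, g(t)) is Lipschitz on [0,T] and for every t ∈ [0,T]: C(t, g(t)) = C(0, x) + ∫₀ᵗ ( ∂ₜC(u, g(u)) + g(u)·λ(u)·C′₊(u, g(u)) ) du. -/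
open MeasureTheory

open Set Filter Topology in
/-- Chain rule through a one-sided derivative, given differentiability of the composite. -/
lemma aux_space (f g : ℝ → ℝ) (u c c' g' d : ℝ)
    (hr : HasDerivWithinAt f c (Ioi (g u)) (g u))
    (hl : HasDerivWithinAt f c' (Iio (g u)) (g u))
    (hg : HasDerivAt g g' u) (hd : HasDerivAt (f ∘ g) d u) : d = c * g' := by
  have hr' : HasDerivWithinAt f c (Ici (g u)) (g u) := hr.Ici_of_Ioi
  have hl' : HasDerivWithinAt f c' (Iic (g u)) (g u) := hl.Iic_of_Iio
  have hS : HasDerivWithinAt (f ∘ g) (c * g') (g ⁻¹' Ici (g u)) u :=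
    hr'.comp u hg.hasDerivWithinAt (fun _ h => h)
  have hS2 : HasDerivWithinAt (f ∘ g) (c' * g') (g ⁻¹' Iic (g u)) u :=
    hl'.comp u hg.hasDerivWithinAt (fun _ h => h)
  rcases lt_trichotomy g' 0 with h | h | h
  · have hmem : g ⁻¹' Ici (g u) ∈ 𝓝[<] u := by
      have := (hasDerivWithinAt_iff_tendsto_slope' self_notMem_Iio).1
        (hg.hasDerivWithinAt (s := Iio u))
      filter_upwards [this.eventually (gt_mem_nhds h), self_mem_nhdsWithin] with s hs hsu
      rw [slope_def_field] at hs
      have hsu' : s - u < 0 := sub_neg.2 hsu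
      rw [div_neg_iff] at hs
      rcases hs with hs | hs
      · simp only [mem_preimage, mem_Ici]; linarith
      · linarith
    have h1 : HasDerivWithinAt (f ∘ g) (c * g') (Iio u) u := hS.mono_of_mem_nhdsWithin hmem
    exact (uniqueDiffWithinAt_Iio u).eq_deriv _ hd.hasDerivWithinAt h1
  · subst h
    have h1 := (by simpa using hS : HasDerivWithinAt (f ∘ g) 0 (g ⁻¹' Ici (g u)) u).union
      (by simpa using hS2 : HasDerivWithinAt (f ∘ g) 0 (g ⁻¹' Iic (g u)) u)
    rw [← preimage_union, Ici_union_Iic, preimage_univ, hasDerivWithinAt_univ] at h1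
    simpa using hd.unique h1
  · have hmem : g ⁻¹' Ici (g u) ∈ 𝓝[>] u := by
      have := (hasDerivWithinAt_iff_tendsto_slope' self_notMem_Ioi).1
        (hg.hasDerivWithinAt (s := Ioi u))
      filter_upwards [this.eventually (lt_mem_nhds h), self_mem_nhdsWithin] with s hs hsu
      rw [slope_def_field] at hs
      have hsu' : 0 < s - u := sub_pos.2 hsu
      rw [div_pos_iff] at hs
      rcases hs with hs | hs
      · simp only [mem_preimage, mem_Ici]; linarith
      · linarith
    have h1 : HasDerivWithinAt (f ∘ g) (c * g') (Ioi u) u := hS.mono_of_mem_nhdsWithin hmem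
    exact (uniqueDiffWithinAt_Ioi u).eq_deriv _ hd.hasDerivWithinAt h1

open Set Filter Topology in
/-- The time part of the increment is differentiable. -/
lemma aux_time (T : ℝ) (C : ℝ → ℝ → ℝ)
    (htdiff : ∀ y ∈ Set.Ioi (0 : ℝ),
      DifferentiableOn ℝ (fun t => C t y) (Set.Icc 0 T))
    (htcont : ContinuousOn
      (fun p : ℝ × ℝ => derivWithin (fun t => C t p.2) (Set.Icc 0 T) p.1)
      (Set.Icc 0 T ×ˢ Set.Ioi 0))
    (g : ℝ → ℝ) (u : ℝ) (hu : u ∈ Ioo 0 T) (hgpos : ∀ s, 0 < g s) (hgc : ContinuousAt g u) :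
    HasDerivAt (fun s => C s (g s) - C u (g s))
      (derivWithin (fun s => C s (g u)) (Icc 0 T) u) u := by
  set D := derivWithin (fun s => C s (g u)) (Icc 0 T) u with hD
  have huI : u ∈ Icc 0 T := ⟨hu.1.le, hu.2.le⟩
  rw [hasDerivAt_iff_isLittleO, Asymptotics.isLittleO_iff]
  intro ε hε
  have hc := htcont (u, g u) ⟨huI, hgpos u⟩
  rw [Metric.continuousWithinAt_iff] at hc
  obtain ⟨δ, hδ, hc⟩ := hc ε hε
  filter_upwards [Metric.ball_mem_nhds u hδ, hgc (Metric.ball_mem_nhds (g u) hδ),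
    Ioo_mem_nhds hu.1 hu.2] with s hs hgs hsI
  have hsub : uIcc u s ⊆ Icc 0 T := by
    apply uIcc_subset_Icc huI ⟨hsI.1.le, hsI.2.le⟩
  have key := (convex_uIcc u s).norm_image_sub_le_of_norm_hasDerivWithin_le
    (f := fun r => C r (g s) - r * D)
    (f' := fun r => derivWithin (fun t => C t (g s)) (Icc 0 T) r - D) (C := ε) (x := u) (y := s)
    (fun r hr => by
      have h1 := ((htdiff (g s) (hgpos s) r (hsub hr)).hasDerivWithinAt.mono hsub)
      have h2 := ((hasDerivWithinAt_id r (uIcc u s)).mul_const D)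
      simpa using h1.fun_sub h2)
    (fun r hr => by
      have h1 : dist (r, g s) (u, g u) < δ := by
        rw [Prod.dist_eq, max_lt_iff]
        refine ⟨?_, hgs⟩
        rw [Metric.mem_ball, Real.dist_eq] at hs
        rw [Real.dist_eq]
        exact (abs_sub_left_of_mem_uIcc hr).trans_lt hs
      have := hc (x := (r, g s)) ⟨hsub hr, hgpos s⟩ h1
      rw [dist_eq_norm] at this
      exact this.le) left_mem_uIcc right_mem_uIcc
  convert! key using 2
  simp only [smul_eq_mul]
  ring

open Set in
/-- Convex functions with bounded one-sided derivatives are Lipschitz. -/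
lemma aux_lip (f : ℝ → ℝ) (L : ℝ) (hconv : ConvexOn ℝ (Ioi 0) f)
    (hrd : ∀ y ∈ Set.Ioi (0 : ℝ), DifferentiableWithinAt ℝ f (Set.Ioi y) y ∧
        |derivWithin f (Set.Ioi y) y| ≤ L)
    (hld : ∀ y ∈ Set.Ioi (0 : ℝ), DifferentiableWithinAt ℝ f (Set.Iio y) y ∧
        |derivWithin f (Set.Iio y) y| ≤ L) (a b : ℝ) (ha : 0 < a) (hb : 0 < b) :
    |f b - f a| ≤ L * |b - a| := by
  have main : ∀ a b : ℝ, 0 < a → 0 < b → a < b → |f b - f a| ≤ L * |b - a| := by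
    intro a b ha hb hab
    have h1 := hconv.rightDeriv_le_slope ha hb hab (hrd a ha).1
    have h2 := hconv.slope_le_leftDeriv ha hb hab (hld b hb).1
    have h3 := (abs_le.1 (hrd a ha).2).1
    have h4 := (abs_le.1 (hld b hb).2).2
    have hpos : 0 < b - a := sub_pos.2 hab
    have h5 : |slope f a b| ≤ L := abs_le.2 ⟨h3.trans h1, h2.trans h4⟩
    rw [slope_def_field, abs_div, div_le_iff₀ (abs_pos.2 hpos.ne')] at h5
    exact h5
  rcases lt_trichotomy a b with h | h | h
  · exact main a b ha hb h
  · subst h; simp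
  · rw [abs_sub_comm, abs_sub_comm b]; exact main b a hb ha h



/-- Non-smooth chain rule between jumps (Proposition 5.7, continuous part).
If `C(t,y)` is `C¹` in time (with jointly continuous time derivative) and convex in `y`
with one-sided derivatives bounded by `L`, and `g(t) = x·exp(∫₀ᵗ λ)` for a bounded
measurable `λ`, then `t ↦ C(t, g(t))` is Lipschitz on `[0,T]` and equals the integral of
the chain-rule expression with the right-hand space derivative. -/
theorem nonsmooth_chain_rule_between_jumps
    (T x L : ℝ) (hT : 0 < T) (hx : 0 < x) (hL : 0 < L)
    (C : ℝ → ℝ → ℝ)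
    (htdiff : ∀ y ∈ Set.Ioi (0 : ℝ),
      DifferentiableOn ℝ (fun t => C t y) (Set.Icc 0 T))
    (htcont : ContinuousOn
      (fun p : ℝ × ℝ => derivWithin (fun t => C t p.2) (Set.Icc 0 T) p.1)
      (Set.Icc 0 T ×ˢ Set.Ioi 0))
    (hconv : ∀ t ∈ Set.Icc (0 : ℝ) T, ConvexOn ℝ (Set.Ioi 0) (C t))
    (hrd : ∀ t ∈ Set.Icc (0 : ℝ) T, ∀ y ∈ Set.Ioi (0 : ℝ),
      DifferentiableWithinAt ℝ (C t) (Set.Ioi y) y ∧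
        |derivWithin (C t) (Set.Ioi y) y| ≤ L)
    (hld : ∀ t ∈ Set.Icc (0 : ℝ) T, ∀ y ∈ Set.Ioi (0 : ℝ),
      DifferentiableWithinAt ℝ (C t) (Set.Iio y) y ∧
        |derivWithin (C t) (Set.Iio y) y| ≤ L)
    (lam : ℝ → ℝ) (hlammeas : Measurable lam)
    (M : ℝ) (hlambd : ∀ u, |lam u| ≤ M)
    (g : ℝ → ℝ) (hg : ∀ t, g t = x * Real.exp (∫ u in (0 : ℝ)..t, lam u)) :
    (∃ K : NNReal, LipschitzOnWith K (fun t => C t (g t)) (Set.Icc 0 T)) ∧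
    ∀ t ∈ Set.Icc (0 : ℝ) T,
      C t (g t) = C 0 x + ∫ u in (0 : ℝ)..t,
        (derivWithin (fun s => C s (g u)) (Set.Icc 0 T) u
          + g u * lam u * derivWithin (C u) (Set.Ioi (g u)) (g u)) := by
  have hM : 0 ≤ M := (abs_nonneg _).trans (hlambd 0)
  have hgpos : ∀ s, 0 < g s := fun s => by rw [hg]; positivity
  have hloc : LocallyIntegrable lam volume := by
    refine (locallyIntegrable_const M).mono hlammeas.aestronglyMeasurable ?_
    exact Filter.Eventually.of_forall fun u => by
      simpa [abs_of_nonneg hM] using hlambd u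
  have hint : ∀ a b, IntervalIntegrable lam volume a b := fun a b =>
    intervalIntegrable_iff.mpr <|
      (hloc.integrableOn_isCompact isCompact_uIcc).mono_set Set.uIoc_subset_uIcc
  have hIlip : ∀ s t, |(∫ u in (0 : ℝ)..t, lam u) - ∫ u in (0 : ℝ)..s, lam u| ≤ M * |t - s| := by
    intro s t
    rw [intervalIntegral.integral_interval_sub_left (hint _ _) (hint _ _)]
    rw [← Real.norm_eq_abs]
    exact intervalIntegral.norm_integral_le_of_norm_le_const fun u _ => (Real.norm_eq_abs _).trans_le (hlambd u)
  have hIcont : Continuous fun t => ∫ u in (0 : ℝ)..t, lam u :=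
    intervalIntegral.continuous_primitive hint 0
  have hgc : Continuous g := by
    have : g = fun t => x * Real.exp (∫ u in (0 : ℝ)..t, lam u) := funext hg
    rw [this]; fun_prop
  -- bounds for `g` on `[0,T]`
  have hIb : ∀ t ∈ Set.Icc 0 T, |∫ u in (0 : ℝ)..t, lam u| ≤ M * T := by
    intro t ht
    have := hIlip 0 t
    simp only [intervalIntegral.integral_same, sub_zero, abs_of_nonneg ht.1] at this
    exact this.trans (mul_le_mul_of_nonneg_left ht.2 hM)
  set E := Real.exp (M * T) with hE
  have hEpos : 0 < E := Real.exp_pos _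
  have hglip : ∀ s ∈ Set.Icc 0 T, ∀ t ∈ Set.Icc 0 T, |g t - g s| ≤ x * E * M * |t - s| := by
    intro s hs t ht
    have h1 := (convex_Icc (-(M*T)) (M*T)).norm_image_sub_le_of_norm_hasDerivWithin_le
      (f := Real.exp) (f' := Real.exp) (C := E)
      (fun r _ => (Real.hasDerivAt_exp r).hasDerivWithinAt)
      (fun r hr => by
        rw [Real.norm_eq_abs, abs_of_pos (Real.exp_pos r)]
        exact Real.exp_le_exp.2 hr.2) (abs_le.1 (hIb s hs)) (abs_le.1 (hIb t ht))
    rw [Real.norm_eq_abs, Real.norm_eq_abs] at h1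
    rw [hg, hg, ← mul_sub, abs_mul, abs_of_pos hx]
    calc _ ≤ x * (E * (M * |t - s|)) := by
          gcongr
          exact h1.trans (mul_le_mul_of_nonneg_left (hIlip s t) hEpos.le)
      _ = _ := by ring
  have hK : IsCompact (g '' Set.Icc 0 T) := isCompact_Icc.image hgc
  obtain ⟨B, hB⟩ := (isCompact_Icc.prod hK).exists_bound_of_continuousOn
    (htcont.mono (Set.prod_mono subset_rfl (by rintro _ ⟨s, _, rfl⟩; exact hgpos s)))
  have hLip : ∃ K : NNReal, LipschitzOnWith K (fun t => C t (g t)) (Set.Icc 0 T) := by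
    refine ⟨(B + L * (x * E * M)).toNNReal, LipschitzOnWith.of_dist_le_mul ?_⟩
    intro t ht s hs
    have h1 : |C t (g t) - C s (g t)| ≤ B * |t - s| :=
      (convex_Icc 0 T).norm_image_sub_le_of_norm_derivWithin_le (htdiff (g t) (hgpos t))
        (fun r hr => hB (r, g t) ⟨hr, Set.mem_image_of_mem g ht⟩) hs ht
    have h2 := aux_lip (C s) L (hconv s hs) (hrd s hs) (hld s hs) (g s) (g t) (hgpos s) (hgpos t)
    have h3 := mul_le_mul_of_nonneg_left (hglip s hs t ht) hL.le
    rw [Real.dist_eq, Real.dist_eq]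
    calc |C t (g t) - C s (g s)| ≤ |C t (g t) - C s (g t)| + |C s (g t) - C s (g s)| :=
          abs_sub_le _ _ _
      _ ≤ (B + L * (x * E * M)) * |t - s| := by linarith
      _ ≤ _ := mul_le_mul_of_nonneg_right (Real.le_coe_toNNReal _) (abs_nonneg _)
  refine ⟨hLip, fun t ht => ?_⟩
  obtain ⟨K, hK⟩ := hLip
  have hsub : Set.uIcc 0 t ⊆ Set.Icc 0 T := by
    rw [Set.uIcc_of_le ht.1]; exact Set.Icc_subset_Icc_right ht.2
  have hac := (hK.mono hsub).absolutelyContinuousOnInterval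
  have hftc := hac.integral_deriv_eq_sub
  have hg0 : g 0 = x := by simp [hg]
  have hcongr : ∫ u in (0 : ℝ)..t,
        (derivWithin (fun s => C s (g u)) (Set.Icc 0 T) u
          + g u * lam u * derivWithin (C u) (Set.Ioi (g u)) (g u))
      = ∫ u in (0 : ℝ)..t, deriv (fun t => C t (g t)) u := by
    apply intervalIntegral.integral_congr_ae
    have hneT : ∀ᵐ u : ℝ, u ≠ T := Measure.ae_ne volume T
    filter_upwards [hac.ae_differentiableAt, LocallyIntegrable.ae_hasDerivAt_integral hloc, hneT]
      with u hdu hIu huT hu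
    have hFd := (hdu (Set.uIoc_subset_uIcc hu)).hasDerivAt
    rw [Set.uIoc_of_le ht.1] at hu
    have huI : u ∈ Set.Ioo 0 T := ⟨hu.1, lt_of_le_of_ne (hu.2.trans ht.2) huT⟩
    have huI' : u ∈ Set.Icc 0 T := ⟨huI.1.le, huI.2.le⟩
    have hgd : HasDerivAt g (g u * lam u) u := by
      have h := ((hIu 0).exp).const_mul x
      rw [← mul_assoc, ← hg] at h
      rwa [show g = fun t => x * Real.exp (∫ u in (0 : ℝ)..t, lam u) from funext hg] at h ⊢
    have hA := aux_time T C htdiff htcont g u huI hgpos hgc.continuousAt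
    have hcomp : HasDerivAt (C u ∘ g) (deriv (fun t => C t (g t)) u -
        derivWithin (fun s => C s (g u)) (Set.Icc 0 T) u) u := by
      have h := hFd.sub hA
      refine h.congr_of_eventuallyEq (Filter.Eventually.of_forall fun s => ?_)
      simp
    have := aux_space (C u) g u _ _ _ _ (hrd u huI' (g u) (hgpos u)).1.hasDerivWithinAt
      (hld u huI' (g u) (hgpos u)).1.hasDerivWithinAt hgd hcomp
    linarith
  rw [hcongr, hftc, hg0]
  ring
end

section
/- Fix T > 0, x > 0 and L > 0. Let C : [0,T] × (0,∞) → ℝ satisfy: (i) for each y > 0 the map t ↦ C(t,y) is differentiable on [0,T] and the partial derivative ∂ₜC is jointly continuous on [0,T] × (0,∞); (ii) for each t ∈ [0,T] the map y ↦ C(t,y) is convex with one-sided derivatives bounded in absolute value by L; let C′₊(t,y) denote the right-hand derivative of y ↦ C(t,y). Let λ : [0,T] → ℝ be bounded and measurable, let 0 < τ₁ < τ₂ < … < τ_n ≤ T, and let p : [0,T] → ℝ be the right-continuous piecewise-constant function with p(0) = 0 that is constant on each interval [τ_{i−1}, τ_i) and on [τ_n, T], jumping only at the times τ_i. Define S(t)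 := x · exp( ∫₀ᵗ λ(u) du + p(t) ) and S(t⁻) := x · exp( ∫₀ᵗ λ(u) du + p(t⁻) ), where p(t⁻) is the left limit of p at t. Then for every t ∈ [0,T]: C(t, S(t)) = C(0, x) + ∫₀ᵗ ( ∂ₜC(u, S(u)) + S(u)·λ(u)·C′₊(u, S(u)) ) du + Σ_{i : τ_i ≤ t} ( C(τ_i, S(τ_i)) − C(τ_i, S(τ_i⁻)) ). -/
open MeasureTheory Filter Topology

lemma aux_lip_space {f : ℝ → ℝ} {L : ℝ} (hconv : ConvexOn ℝ (Set.Ioi 0) f)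
    (hr : ∀ y ∈ Set.Ioi (0 : ℝ), DifferentiableWithinAt ℝ f (Set.Ioi y) y ∧
        |derivWithin f (Set.Ioi y) y| ≤ L)
    (hl : ∀ y ∈ Set.Ioi (0 : ℝ), DifferentiableWithinAt ℝ f (Set.Iio y) y ∧
        |derivWithin f (Set.Iio y) y| ≤ L)
    {y z : ℝ} (hy : 0 < y) (hz : 0 < z) : |f y - f z| ≤ L * |y - z| := by
  have key : ∀ y z : ℝ, 0 < y → 0 < z → y < z → |f y - f z| ≤ L * |y - z| := by
    intro y z hy hz hyz
    have h1 := hconv.rightDeriv_le_slope hy hz hyz (hr y hy).1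
    have h2 := hconv.slope_le_leftDeriv hy hz hyz (hl z hz).1
    have h3 := (abs_le.1 (hr y hy).2).1
    have h4 := (abs_le.1 (hl z hz).2).2
    have h5 : |slope f y z| ≤ L := abs_le.2 ⟨by linarith, by linarith⟩
    rw [slope_def_field, abs_div, div_le_iff₀ (abs_pos.2 (by linarith))] at h5
    rw [abs_sub_comm, abs_sub_comm y]
    exact h5
  rcases lt_trichotomy y z with h | h | h
  · exact key y z hy hz h
  · simp [h]
  · rw [abs_sub_comm, abs_sub_comm y]
    exact key z y hz hy h

lemma aux_space_deriv {f Y : ℝ → ℝ} {L u Y' e : ℝ} (hY : HasDerivAt Y Y' u) (hpos : 0 < Y u)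
    (hlip : ∀ y z : ℝ, 0 < y → 0 < z → |f y - f z| ≤ L * |y - z|)
    (hr : DifferentiableWithinAt ℝ f (Set.Ioi (Y u)) (Y u))
    (he : HasDerivAt (fun v => f (Y v)) e u) :
    e = Y' * derivWithin f (Set.Ioi (Y u)) (Y u) := by
  rcases eq_or_ne Y' 0 with h0 | h0
  · subst h0
    have h1 : HasDerivAt (fun v => f (Y v)) 0 u := by
      rw [hasDerivAt_iff_isLittleO] at hY ⊢
      simp only [smul_zero, sub_zero] at hY ⊢
      refine Asymptotics.IsBigO.trans_isLittleO ?_ hY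
      refine Asymptotics.IsBigO.of_bound L ?_
      have hc : ∀ᶠ v in 𝓝 u, 0 < Y v := by
        have : ContinuousAt Y u := by
          by_contra hcon
          exact hcon (HasDerivAt.continuousAt (f' := 0) (by
            rw [hasDerivAt_iff_isLittleO]; simpa using hY))
        exact this.eventually (lt_mem_nhds hpos)
      filter_upwards [hc] with v hv
      simpa using hlip _ _ hv hpos
    rw [he.unique h1, zero_mul]
  · have hcomp : ∀ s : Set ℝ, UniqueDiffWithinAt ℝ s u →
        (∀ᶠ v in 𝓝[s] u, Y u < Y v) → e = Y' * derivWithin f (Set.Ioi (Y u)) (Y u) := by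
      intro s hs hev
      have hmem : {v | Y u < Y v} ∈ 𝓝[s] u := hev
      have h1 : HasDerivWithinAt (fun v => f (Y v))
          (derivWithin f (Set.Ioi (Y u)) (Y u) * Y') {v | Y u < Y v} u :=
        HasDerivWithinAt.comp (h₂ := f) (h := Y) u hr.hasDerivWithinAt
          hY.hasDerivWithinAt (fun v hv => hv)
      have h2 := h1.mono_of_mem_nhdsWithin hmem
      rw [mul_comm]
      exact hs.eq_deriv s he.hasDerivWithinAt h2
    have hsl := hasDerivAt_iff_tendsto_slope.1 hY
    rcases lt_or_gt_of_ne h0 with hneg | hpos'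
    · refine hcomp (Set.Iio u) (uniqueDiffWithinAt_Iio u) ?_
      have h3 := (hsl.eventually (gt_mem_nhds hneg)).filter_mono
        (nhdsWithin_mono u (s := Set.Iio u) (fun v hv => ne_of_lt hv))
      filter_upwards [h3, self_mem_nhdsWithin] with v hv hv2
      rw [slope_def_field, div_lt_iff_of_neg (sub_neg.2 hv2)] at hv
      linarith
    · refine hcomp (Set.Ioi u) (uniqueDiffWithinAt_Ioi u) ?_
      have h3 := (hsl.eventually (lt_mem_nhds hpos')).filter_mono
        (nhdsWithin_mono u (s := Set.Ioi u) (fun v hv => ne_of_gt hv))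
      filter_upwards [h3, self_mem_nhdsWithin] with v hv hv2
      rw [slope_def_field, lt_div_iff₀ (sub_pos.2 hv2)] at hv
      linarith

lemma aux_time_deriv {T u : ℝ} {C : ℝ → ℝ → ℝ} {Y : ℝ → ℝ}
    (htdiff : ∀ y ∈ Set.Ioi (0 : ℝ),
      DifferentiableOn ℝ (fun t => C t y) (Set.Icc 0 T))
    (htcont : ContinuousOn
      (fun p : ℝ × ℝ => derivWithin (fun t => C t p.2) (Set.Icc 0 T) p.1)
      (Set.Icc 0 T ×ˢ Set.Ioi 0))
    (hu : u ∈ Set.Ioo 0 T) (hY : ContinuousAt Y u) (hpos : 0 < Y u) :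
    HasDerivAt (fun v => C v (Y v) - C u (Y v))
      (derivWithin (fun s => C s (Y u)) (Set.Icc 0 T) u) u := by
  set d := derivWithin (fun s => C s (Y u)) (Set.Icc 0 T) u with hd
  rw [hasDerivAt_iff_isLittleO, Asymptotics.isLittleO_iff]
  intro ε hε
  have hnh : Set.Icc 0 T ×ˢ Set.Ioi 0 ∈ 𝓝 (u, Y u) :=
    prod_mem_nhds (Icc_mem_nhds hu.1 hu.2) (Ioi_mem_nhds hpos)
  have hca := htcont.continuousAt hnh
  have hev := (Metric.continuousAt_iff.1 hca) ε hε
  obtain ⟨δ, hδ, hδ2⟩ := hev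
  have hY1 : ∀ᶠ v in 𝓝 u, dist (Y v) (Y u) < δ := hY.eventually (Metric.ball_mem_nhds _ hδ)
  have hY2 : ∀ᶠ v in 𝓝 u, 0 < Y v := hY.eventually (lt_mem_nhds hpos)
  have hv3 : ∀ᶠ v in 𝓝 u, v ∈ Metric.ball u δ := Metric.ball_mem_nhds _ hδ
  have hv4 : ∀ᶠ v in 𝓝 u, v ∈ Set.Icc 0 T := Icc_mem_nhds hu.1 hu.2
  filter_upwards [hY1, hY2, hv3, hv4] with v h1 h2 h3 h4
  have hconv : Convex ℝ (Metric.ball u δ ∩ Set.Icc 0 T) :=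
    (convex_ball u δ).inter (convex_Icc 0 T)
  have hmv := hconv.norm_image_sub_le_of_norm_hasDerivWithin_le (𝕜 := ℝ)
    (f := fun s => C s (Y v) - s * d)
    (f' := fun s => derivWithin (fun t => C t (Y v)) (Set.Icc 0 T) s - 1 * d) (C := ε)
    (x := u) (y := v)
    (fun s hs => ((htdiff _ h2 s hs.2).hasDerivWithinAt.mono Set.inter_subset_right).sub
      ((hasDerivWithinAt_id s _).mul_const d))
    (fun s hs => by
      have := @hδ2 (s, Y v) (by
        rw [Prod.dist_eq]; exact max_lt hs.1 h1)
      rw [dist_eq_norm] at this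
      simpa using this.le)
    ⟨Metric.mem_ball_self hδ, hu.1.le, hu.2.le⟩ ⟨h3, h4⟩
  convert hmv using 2
  simp only [smul_eq_mul]
  ring

lemma aux_lip_s10 {T L a b : ℝ} {C : ℝ → ℝ → ℝ} {Y : ℝ → ℝ} {K : NNReal}
    (htdiff : ∀ y ∈ Set.Ioi (0 : ℝ),
      DifferentiableOn ℝ (fun t => C t y) (Set.Icc 0 T))
    (htcont : ContinuousOn
      (fun p : ℝ × ℝ => derivWithin (fun t => C t p.2) (Set.Icc 0 T) p.1)
      (Set.Icc 0 T ×ˢ Set.Ioi 0))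
    (hL : 0 ≤ L)
    (hlip : ∀ t ∈ Set.Icc 0 T, ∀ y z : ℝ, 0 < y → 0 < z → |C t y - C t z| ≤ L * |y - z|)
    (hab : Set.Icc a b ⊆ Set.Icc 0 T)
    (hY : LipschitzOnWith K Y (Set.Icc a b)) (hpos : ∀ v, 0 < Y v) :
    ∃ K' : NNReal, LipschitzOnWith K' (fun v => C v (Y v)) (Set.Icc a b) := by
  have hcomp : IsCompact (Set.Icc 0 T ×ˢ (Y '' Set.Icc a b)) :=
    isCompact_Icc.prod (isCompact_Icc.image_of_continuousOn hY.continuousOn)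
  obtain ⟨B, hB⟩ := hcomp.exists_bound_of_continuousOn (htcont.mono (by
    refine Set.prod_mono le_rfl ?_
    rintro _ ⟨v, _, rfl⟩
    exact hpos v))
  refine ⟨(max B 0 + L * K).toNNReal, LipschitzOnWith.of_dist_le_mul ?_⟩
  intro v hv w hw
  rw [Real.coe_toNNReal _ (by positivity)]
  have h1 := (convex_Icc (0:ℝ) T).norm_image_sub_le_of_norm_derivWithin_le (𝕜 := ℝ)
    (f := fun s => C s (Y v)) (C := B) (x := w) (y := v) (htdiff _ (hpos v))
    (fun s hs => hB (s, Y v) ⟨hs, v, hv, rfl⟩) (hab hw) (hab hv)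
  have h2 := hlip w (hab hw) (Y v) (Y w) (hpos v) (hpos w)
  have h3 := hY.dist_le_mul v hv w hw
  rw [Real.dist_eq] at h3 ⊢
  simp only [Real.norm_eq_abs] at h1
  have h4 : |C v (Y v) - C w (Y w)| ≤ |C v (Y v) - C w (Y v)| + |C w (Y v) - C w (Y w)| :=
    abs_sub_le _ _ _
  have h5 := mul_le_mul_of_nonneg_left h3 hL
  have h6 := mul_le_mul_of_nonneg_right (le_max_left B 0) (abs_nonneg (v - w))
  rw [Real.dist_eq] at *
  nlinarith

lemma aux_path_lip {x M c a b : ℝ} (hx : 0 < x) {lam : ℝ → ℝ} 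
    (hli : ∀ a b, IntervalIntegrable lam volume a b) (hlambd : ∀ u, |lam u| ≤ M) :
    ∃ K : NNReal, LipschitzOnWith K
      (fun t => x * Real.exp ((∫ u in (0 : ℝ)..t, lam u) + c)) (Set.Icc a b) := by
  have hM : 0 ≤ M := (abs_nonneg _).trans (hlambd 0)
  have h1 : LipschitzWith M.toNNReal (fun t => (∫ u in (0 : ℝ)..t, lam u) + c) := by
    refine LipschitzWith.of_dist_le_mul fun v w => ?_
    rw [Real.dist_eq, Real.dist_eq, add_sub_add_right_eq_sub,
      intervalIntegral.integral_interval_sub_left (hli _ _) (hli _ _), Real.coe_toNNReal _ hM]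
    simpa using intervalIntegral.norm_integral_le_of_norm_le_const (a := w) (b := v) (f := lam)
      (C := M) (fun u _ => hlambd u)
  set g := (fun t => (∫ u in (0 : ℝ)..t, lam u) + c) with hg
  obtain ⟨B, hB⟩ := (isCompact_Icc (a := a) (b := b)).exists_bound_of_continuousOn
    h1.continuous.continuousOn
  refine ⟨(x * Real.exp B * M).toNNReal, LipschitzOnWith.of_dist_le_mul fun v hv w hw => ?_⟩
  rw [Real.coe_toNNReal _ (by positivity)]
  have h2 := (convex_Iic B).norm_image_sub_le_of_norm_hasDerivWithin_le (𝕜 := ℝ)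
    (f := Real.exp) (f' := Real.exp) (C := Real.exp B) (x := g w) (y := g v)
    (fun s _ => (Real.hasDerivAt_exp s).hasDerivWithinAt)
    (fun s hs => by
      rw [Real.norm_eq_abs, Real.abs_exp]; exact Real.exp_le_exp.2 hs)
    ((le_abs_self _).trans (hB w hw)) ((le_abs_self _).trans (hB v hv))
  have h3 := h1.dist_le_mul v w
  rw [Real.coe_toNNReal _ hM, Real.dist_eq] at h3
  rw [Real.dist_eq]
  change |x * Real.exp (g v) - x * Real.exp (g w)| ≤ _
  rw [← mul_sub, abs_mul, abs_of_pos hx, mul_assoc, mul_assoc]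
  refine mul_le_mul_of_nonneg_left (h2.trans ?_) hx.le
  exact mul_le_mul_of_nonneg_left h3 (Real.exp_pos _).le

lemma aux_segment {T x L : ℝ} (hx : 0 < x) (hL : 0 < L)
    {C : ℝ → ℝ → ℝ}
    (htdiff : ∀ y ∈ Set.Ioi (0 : ℝ),
      DifferentiableOn ℝ (fun t => C t y) (Set.Icc 0 T))
    (htcont : ContinuousOn
      (fun p : ℝ × ℝ => derivWithin (fun t => C t p.2) (Set.Icc 0 T) p.1)
      (Set.Icc 0 T ×ˢ Set.Ioi 0))
    (hconv : ∀ t ∈ Set.Icc (0 : ℝ) T, ConvexOn ℝ (Set.Ioi 0) (C t))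
    (hrd : ∀ t ∈ Set.Icc (0 : ℝ) T, ∀ y ∈ Set.Ioi (0 : ℝ),
      DifferentiableWithinAt ℝ (C t) (Set.Ioi y) y ∧
        |derivWithin (C t) (Set.Ioi y) y| ≤ L)
    (hld : ∀ t ∈ Set.Icc (0 : ℝ) T, ∀ y ∈ Set.Ioi (0 : ℝ),
      DifferentiableWithinAt ℝ (C t) (Set.Iio y) y ∧
        |derivWithin (C t) (Set.Iio y) y| ≤ L)
    {lam : ℝ → ℝ} (hlammeas : Measurable lam)
    {M : ℝ} (hlambd : ∀ u, |lam u| ≤ M) {a b c : ℝ} (ha : 0 ≤ a) (hab : a ≤ b) (hb : b ≤ T)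
    {S : ℝ → ℝ}
    (hS : ∀ t ∈ Set.Ioo a b, S t = x * Real.exp ((∫ u in (0 : ℝ)..t, lam u) + c)) :
    IntervalIntegrable (fun u => derivWithin (fun s => C s (S u)) (Set.Icc 0 T) u
              + S u * lam u * derivWithin (C u) (Set.Ioi (S u)) (S u)) volume a b ∧
    (∫ u in a..b, (derivWithin (fun s => C s (S u)) (Set.Icc 0 T) u
              + S u * lam u * derivWithin (C u) (Set.Ioi (S u)) (S u))) =
      C b (x * Real.exp ((∫ u in (0 : ℝ)..b, lam u) + c))
        - C a (x * Real.exp ((∫ u in (0 : ℝ)..a, lam u) + c)) := by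
  have hloc : LocallyIntegrable lam volume := by
    refine (locallyIntegrable_const M).mono hlammeas.aestronglyMeasurable ?_
    filter_upwards with u
    exact (hlambd u).trans (le_abs_self M)
  have hli : ∀ a b, IntervalIntegrable lam volume a b := fun a b =>
    intervalIntegrable_iff.mpr <|
      (hloc.integrableOn_isCompact isCompact_uIcc).mono_set Set.uIoc_subset_uIcc
  set Y : ℝ → ℝ := fun t => x * Real.exp ((∫ u in (0 : ℝ)..t, lam u) + c) with hY
  have hYpos : ∀ v, 0 < Y v := fun v => by positivity
  obtain ⟨K, hK⟩ := aux_path_lip (c := c) (a := a) (b := b) hx hli hlambd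
  have hlip : ∀ t ∈ Set.Icc 0 T, ∀ y z : ℝ, 0 < y → 0 < z → |C t y - C t z| ≤ L * |y - z| :=
    fun t ht y z hy hz => aux_lip_space (hconv t ht) (hrd t ht) (hld t ht) hy hz
  obtain ⟨K', hK'⟩ := aux_lip_s10 htdiff htcont hL.le hlip (Set.Icc_subset_Icc ha hb) hK hYpos
  rw [← Set.uIcc_of_le hab] at hK'
  have hac := hK'.absolutelyContinuousOnInterval
  have hae : ∀ᵐ u, u ∈ Set.Ioo a b → deriv (fun v => C v (Y v)) u =
      derivWithin (fun s => C s (S u)) (Set.Icc 0 T) u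
              + S u * lam u * derivWithin (C u) (Set.Ioi (S u)) (S u) := by
    filter_upwards [_root_.LocallyIntegrable.ae_hasDerivAt_integral hloc, hac.ae_differentiableAt] with u h1 h2 hu
    have huab : u ∈ Set.uIcc a b := by
      rw [Set.uIcc_of_le hab]; exact Set.Ioo_subset_Icc_self hu
    have hu0 : u ∈ Set.Ioo 0 T := ⟨by linarith [hu.1], by linarith [hu.2]⟩
    have hYd : HasDerivAt Y (Y u * lam u) u := by
      have := (((h1 0).add_const c).exp).const_mul x
      rw [← mul_assoc] at this
      exact this
    have hF := (h2 huab).hasDerivAt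
    have hA := aux_time_deriv htdiff htcont hu0 hYd.continuousAt (hYpos u)
    have hB := hF.sub hA
    have hB' : HasDerivAt (fun v => C u (Y v)) (deriv (fun v => C v (Y v)) u -
        derivWithin (fun s => C s (Y u)) (Set.Icc 0 T) u) u := by
      refine hB.congr_of_eventuallyEq (Eventually.of_forall fun v => ?_)
      simp [hY]
    have he := aux_space_deriv hYd (hYpos u) (hlip u (Set.Ioo_subset_Icc_self hu0))
      (hrd u (Set.Ioo_subset_Icc_self hu0) _ (hYpos u)).1 hB'
    have hSY : S u = Y u := hS u hu
    rw [hSY]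
    linarith
  have hae2 : ∀ᵐ u, u ∈ Set.uIoc a b → deriv (fun v => C v (Y v)) u =
      derivWithin (fun s => C s (S u)) (Set.Icc 0 T) u
              + S u * lam u * derivWithin (C u) (Set.Ioi (S u)) (S u) := by
    have hne : ∀ᵐ u : ℝ, u ≠ b := by simp [ae_iff, measure_singleton]
    filter_upwards [hae, hne] with u h1 h2 hu
    rw [Set.uIoc_of_le hab] at hu
    exact h1 ⟨hu.1, lt_of_le_of_ne hu.2 h2⟩
  refine ⟨hac.intervalIntegrable_deriv.congr_ae ?_, ?_⟩
  · exact (ae_restrict_iff' measurableSet_uIoc).2 hae2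
  · rw [← intervalIntegral.integral_congr_ae hae2, hac.integral_deriv_eq_sub]

/-- Non-smooth Itô formula for a finite-activity pure-jump path
(Proposition 5.7). `C(t,y)` is `C¹` in time (with jointly continuous time derivative)
and convex in `y` with one-sided derivatives bounded by `L`. The stock path
`S(t) = x·exp(∫₀ᵗ λ + p(t))` has finitely many jumps at times `0 < τ₁ < … < τₙ ≤ T`
(encoded by jump sizes `j i` accumulated in the right-continuous piecewise-constant
`p`, with left limits in `pm`). Then `C(t, S(t))` equals the initial value plus the
integral of the chain-rule expression (with right-hand space derivative) plus the sum
of jump increments. -/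
theorem nonsmooth_ito_formula_pure_jump
    (T x L : ℝ) (hT : 0 < T) (hx : 0 < x) (hL : 0 < L)
    (C : ℝ → ℝ → ℝ)
    (htdiff : ∀ y ∈ Set.Ioi (0 : ℝ),
      DifferentiableOn ℝ (fun t => C t y) (Set.Icc 0 T))
    (htcont : ContinuousOn
      (fun p : ℝ × ℝ => derivWithin (fun t => C t p.2) (Set.Icc 0 T) p.1)
      (Set.Icc 0 T ×ˢ Set.Ioi 0))
    (hconv : ∀ t ∈ Set.Icc (0 : ℝ) T, ConvexOn ℝ (Set.Ioi 0) (C t))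
    (hrd : ∀ t ∈ Set.Icc (0 : ℝ) T, ∀ y ∈ Set.Ioi (0 : ℝ),
      DifferentiableWithinAt ℝ (C t) (Set.Ioi y) y ∧
        |derivWithin (C t) (Set.Ioi y) y| ≤ L)
    (hld : ∀ t ∈ Set.Icc (0 : ℝ) T, ∀ y ∈ Set.Ioi (0 : ℝ),
      DifferentiableWithinAt ℝ (C t) (Set.Iio y) y ∧
        |derivWithin (C t) (Set.Iio y) y| ≤ L)
    (lam : ℝ → ℝ) (hlammeas : Measurable lam)
    (M : ℝ) (hlambd : ∀ u, |lam u| ≤ M)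
    (n : ℕ) (τ : Fin n → ℝ) (hτmono : StrictMono τ)
    (hτpos : ∀ i, 0 < τ i) (hτle : ∀ i, τ i ≤ T)
    (j : Fin n → ℝ)
    (p pm : ℝ → ℝ)
    (hp : ∀ t, p t = ∑ i ∈ Finset.univ.filter (fun i => τ i ≤ t), j i)
    (hpm : ∀ t, pm t = ∑ i ∈ Finset.univ.filter (fun i => τ i < t), j i)
    (S Sm : ℝ → ℝ)
    (hS : ∀ t, S t = x * Real.exp ((∫ u in (0 : ℝ)..t, lam u) + p t))
    (hSm : ∀ t, Sm t = x * Real.exp ((∫ u in (0 : ℝ)..t, lam u) + pm t)) :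
    ∀ t ∈ Set.Icc (0 : ℝ) T,
      C t (S t) = C 0 x
        + (∫ u in (0 : ℝ)..t,
            (derivWithin (fun s => C s (S u)) (Set.Icc 0 T) u
              + S u * lam u * derivWithin (C u) (Set.Ioi (S u)) (S u)))
        + ∑ i ∈ Finset.univ.filter (fun i => τ i ≤ t),
            (C (τ i) (S (τ i)) - C (τ i) (Sm (τ i))) := by
  have hseg := fun (a b c : ℝ) (ha : 0 ≤ a) (hab : a ≤ b) (hb : b ≤ T) => aux_segment
    (a := a) (b := b) (c := c) (S := S)
    hx hL htdiff htcont hconv hrd hld hlammeas hlambd ha hab hb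
  set I : ℝ → ℝ := fun u => derivWithin (fun s => C s (S u)) (Set.Icc 0 T) u
              + S u * lam u * derivWithin (C u) (Set.Ioi (S u)) (S u) with hI
  have hins : ∀ m : Fin n, Finset.univ.filter (fun i => τ i ≤ τ m) =
      insert m (Finset.univ.filter (fun i => τ i < τ m)) := by
    intro m
    ext i
    simp only [Finset.mem_filter, Finset.mem_univ, true_and, Finset.mem_insert]
    rw [le_iff_eq_or_lt, hτmono.injective.eq_iff]
  have hjump : ∀ m : Fin n,
      ∑ i ∈ Finset.univ.filter (fun i => τ i ≤ τ m), (C (τ i) (S (τ i)) - C (τ i) (Sm (τ i))) =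
      (C (τ m) (S (τ m)) - C (τ m) (Sm (τ m))) +
      ∑ i ∈ Finset.univ.filter (fun i => τ i < τ m),
        (C (τ i) (S (τ i)) - C (τ i) (Sm (τ i))) := by
    intro m
    rw [hins m, Finset.sum_insert (by simp)]
  have hleft : ∀ k : ℕ, ∀ t ∈ Set.Icc (0 : ℝ) T,
      (Finset.univ.filter (fun i => τ i < t)).card = k →
      IntervalIntegrable I volume 0 t ∧
      C t (Sm t) = C 0 x + (∫ u in (0 : ℝ)..t, I u)
        + ∑ i ∈ Finset.univ.filter (fun i => τ i < t),
            (C (τ i) (S (τ i)) - C (τ i) (Sm (τ i))) := by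
    intro k
    induction k using Nat.strong_induction_on with
    | _ k ih =>
    intro t ht hk
    rcases (Finset.univ.filter (fun i => τ i < t)).eq_empty_or_nonempty with he | hne
    · have hno : ∀ i, t ≤ τ i := by
        intro i
        by_contra hcon
        have : i ∈ Finset.univ.filter (fun i => τ i < t) := by simpa using hcon
        rw [he] at this
        simp at this
      have h1 := hseg 0 t 0 le_rfl ht.1 ht.2 (fun u hu => by
        rw [hS, hp, Finset.filter_false_of_mem, Finset.sum_empty]
        intro i _ 
        exact not_le.2 (lt_of_lt_of_le hu.2 (hno i)))
      refine ⟨h1.1, ?_⟩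
      rw [he, Finset.sum_empty, h1.2, hSm, hpm, he]
      simp
    · obtain ⟨m, hm, hmax⟩ := Finset.exists_max_image _ τ hne
      have hmt : τ m < t := by simpa using hm
      have hmax' : ∀ i, τ i < t → τ i ≤ τ m := fun i hi => hmax i (by simpa using hi)
      have hfil : ∀ u, τ m ≤ u → u < t → Finset.univ.filter (fun i => τ i ≤ u) =
          Finset.univ.filter (fun i => τ i < t) := by
        intro u hu hut
        ext i
        simp only [Finset.mem_filter, Finset.mem_univ, true_and]
        exact ⟨fun h => lt_of_le_of_lt h hut, fun h => (hmax' i h).trans hu⟩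
      have hfm := hfil (τ m) le_rfl hmt
      have hcard : (Finset.univ.filter (fun i => τ i < τ m)).card < k := by
        rw [← hk, ← hfm, hins m, Finset.card_insert_of_notMem (by simp)]
        exact Nat.lt_succ_self _
      obtain ⟨hi1, hi2⟩ := ih _ hcard (τ m) ⟨(hτpos m).le, hτle m⟩ rfl
      have h1 := hseg (τ m) t (pm t) (hτpos m).le hmt.le ht.2 (fun u hu => by
        rw [hS, hp, hfil u hu.1.le hu.2, hpm])
      have hSt : S (τ m) = x * Real.exp ((∫ u in (0 : ℝ)..(τ m), lam u) + pm t) := by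
        rw [hS, hp, hfm, hpm]
      rw [← hSm t, ← hSt] at h1
      refine ⟨hi1.trans h1.1, ?_⟩
      rw [← intervalIntegral.integral_add_adjacent_intervals hi1 h1.1, h1.2, ← hfm, hjump m]
      linarith
  intro t ht
  obtain ⟨-, h2⟩ := hleft _ t ht rfl
  by_cases hex : ∃ m, τ m = t
  · obtain ⟨m, rfl⟩ := hex
    rw [hjump m]
    linarith
  · have hfil : Finset.univ.filter (fun i => τ i ≤ t) =
          Finset.univ.filter (fun i => τ i < t) := by
      ext i
      simp only [Finset.mem_filter, Finset.mem_univ, true_and]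
      exact ⟨fun h => lt_of_le_of_ne h (fun h' => hex ⟨i, h'⟩), le_of_lt⟩
    have hSt : S t = Sm t := by rw [hS, hSm, hp, hpm, hfil]
    rw [hfil, hSt]
    exact h2
end
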